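/- Suppose e is a positive edge battery [e, C, +] in a signed block Σ and C has three or more bridges. Then no edge outside of C lies in a unique positive circle. -/

import Mathlib

open SimpleGraph Finset

variable {V : Type*} [DecidableEq V]

/-- The sign (product of edge signs) of a finite set of edges. -/
def esign (σ : Sym2 V → ℤˣ) (s : Finset (Sym2 V)) : ℤˣ := ∏ e ∈ s, σ e

/-- The sign of a walk: the product of the signs of its edges. -/
def wsign (σ : Sym2 V → ℤˣ) {G : SimpleGraph V} {u v : V} (w : G.Walk u v) : ℤˣ :=
  (w.edges.map σ).prod

/-- `s` is the edge set of a circle (cycle) of `G`. -/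
def IsCircleOf (G : SimpleGraph V) (s : Finset (Sym2 V)) : Prop :=
  ∃ (a : V) (w : G.Walk a a), w.IsCycle ∧ w.edges.toFinset = s

/-- The signature obtained from `σ` by switching with `ζ`. -/
def switchSign (σ : Sym2 V → ℤˣ) (ζ : V → ℤˣ) : Sym2 V → ℤˣ :=
  fun e => Sym2.lift ⟨fun a b => ζ a * σ s(a, b) * ζ b, by
    intro a b
    simp only []
    rw [Sym2.eq_swap]
    simp [mul_comm, mul_assoc, mul_left_comm]⟩ e

/-- `b` is a balancing edge: one can switch so that `b` is the unique negative edge. -/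
def IsBalancingEdge (G : SimpleGraph V) (σ : Sym2 V → ℤˣ) (b : Sym2 V) : Prop :=
  b ∈ G.edgeSet ∧ ∃ ζ : V → ℤˣ, ∀ f ∈ G.edgeSet, (switchSign σ ζ f = -1 ↔ f = b)

/-- `F` is the edge set of a bridge of the circle `w` in `G`: either a single
chord of `w`, or the edge set attached to a connected component of `G` minus
the vertices of `w`. -/
def IsBridgeOf {a : V} (G : SimpleGraph V) (w : G.Walk a a) (F : Set (Sym2 V)) : Prop :=
  (∃ x y : V, x ≠ y ∧ x ∈ w.support ∧ y ∈ w.support ∧ G.Adj x y ∧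
      s(x, y) ∉ w.edges ∧ F = {s(x, y)}) ∨
  (∃ D : Set V, D.Nonempty ∧ (∀ x ∈ D, x ∉ w.support) ∧ (G.induce D).Connected ∧
      (∀ x ∈ D, ∀ y : V, G.Adj x y → y ∈ D ∨ y ∈ w.support) ∧
      F = {e | e ∈ G.edgeSet ∧ ∃ x ∈ D, x ∈ e})

/-- The vertices of attachment of a bridge with edge set `F`. -/
def attachments {a : V} (G : SimpleGraph V) (w : G.Walk a a) (F : Set (Sym2 V)) : Set V :=
  {x | x ∈ w.support ∧ ∃ e ∈ F, x ∈ e}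

/-- A path through a bridge: a path between two distinct vertices of attachment
all of whose edges lie in the bridge. -/
def IsPathThrough {a : V} (G : SimpleGraph V) (w : G.Walk a a) (F : Set (Sym2 V))
    {x y : V} (Q : G.Walk x y) : Prop :=
  x ≠ y ∧ x ∈ attachments G w F ∧ y ∈ attachments G w F ∧ Q.IsPath ∧
    ∀ e ∈ Q.edges, e ∈ F

/-- `G` is a block: it is connected and has no cutpoint. -/
def IsBlock (G : SimpleGraph V) : Prop :=
  G.Connected ∧ ∀ v : V, ((⊤ : G.Subgraph).deleteVerts {v}).coe.Connected

section Walks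

variable {G : SimpleGraph V} {u v x y z : V}

omit [DecidableEq V] in
theorem isPath_append_iff {p : G.Walk u v} {q : G.Walk v x} :
    (p.append q).IsPath ↔
      p.IsPath ∧ q.IsPath ∧ ∀ t, t ∈ p.support → t ∈ q.support → t = v := by
  rw [Walk.isPath_def, Walk.support_append, List.nodup_append, Walk.isPath_def, Walk.isPath_def]
  have hq : q.support = v :: q.support.tail := (Walk.cons_tail_support q).symm
  constructor
  · rintro ⟨h1, h2, h3⟩
    refine ⟨h1, ?_, ?_⟩
    · rw [hq, List.nodup_cons]
      exact ⟨fun h => h3 v p.end_mem_support v h rfl, h2⟩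
    · intro t ht hqt
      rw [hq, List.mem_cons] at hqt
      rcases hqt with h | h
      · exact h
      · exact absurd rfl (h3 t ht t h)
  · rintro ⟨h1, h2, h3⟩
    rw [hq, List.nodup_cons] at h2
    refine ⟨h1, h2.2, ?_⟩
    rintro t ht t' ht' rfl
    have := h3 t ht (by rw [hq]; exact List.mem_cons_of_mem _ ht')
    exact h2.1 (this ▸ ht')

omit [DecidableEq V] in
theorem isCycle_append {p : G.Walk x y} {q : G.Walk y x} (hp : p.IsPath) (hq : q.IsPath)
    (hxy : x ≠ y) (hpq : ∀ t, t ∈ p.support → t ∈ q.support → t = x ∨ t = y)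
    (he : ∀ g, g ∈ p.edges → g ∉ q.edges) : (p.append q).IsCycle := by
  have hp' : p.support = x :: p.support.tail := (Walk.cons_tail_support p).symm
  have hq' : q.support = y :: q.support.tail := (Walk.cons_tail_support q).symm
  rw [Walk.isPath_def] at hp hq
  have hpe := Walk.edges_nodup_of_support_nodup hp
  have hqe := Walk.edges_nodup_of_support_nodup hq
  rw [Walk.isCycle_def, Walk.isTrail_def, Walk.edges_append, Walk.tail_support_append]
  refine ⟨?_, ?_, ?_⟩
  · rw [List.nodup_append]
    exact ⟨hpe, hqe, fun g hg g' hg' h => he g hg (h ▸ hg')⟩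
  · intro h
    have := congrArg Walk.length h
    rw [Walk.length_append, Walk.length_nil] at this
    exact hxy (Walk.eq_of_length_eq_zero (by omega : p.length = 0))
  · rw [hp', List.nodup_cons] at hp
    rw [hq', List.nodup_cons] at hq
    rw [List.nodup_append]
    refine ⟨hp.2, hq.2, ?_⟩
    rintro t ht t' ht' rfl
    rcases hpq t (by rw [hp']; exact List.mem_cons_of_mem _ ht)
      (by rw [hq']; exact List.mem_cons_of_mem _ ht') with h | h
    · exact hp.1 (h ▸ ht)
    · exact hq.1 (h ▸ ht')

omit [DecidableEq V] in
theorem wsign_append (σ : Sym2 V → ℤˣ) (p : G.Walk u v) (q : G.Walk v x) :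
    wsign σ (p.append q) = wsign σ p * wsign σ q := by
  simp [wsign]

omit [DecidableEq V] in
theorem wsign_reverse (σ : Sym2 V → ℤˣ) (p : G.Walk u v) :
    wsign σ p.reverse = wsign σ p := by
  simp [wsign, List.prod_reverse]

theorem esign_toFinset_edges (σ : Sym2 V → ℤˣ) {p : G.Walk u v} (hp : p.IsTrail) :
    esign σ p.edges.toFinset = wsign σ p := by
  rw [esign, wsign, List.prod_toFinset _ hp.edges_nodup]

omit [DecidableEq V] in
theorem exists_eq_append_getVert (P : G.Walk u v) (i : ℕ) (hi : P.getVert i = x) :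
    ∃ (A : G.Walk u x) (B : G.Walk x v), P = A.append B ∧
      ∀ n, i ≤ n → B.getVert (n - i) = P.getVert n := by
  subst hi
  refine ⟨P.take i, P.drop i, by simp, fun n hn => ?_⟩
  rw [Walk.drop_getVert, Nat.add_sub_cancel' hn]

omit [DecidableEq V] in
theorem exists_eq_append_of_mem_edges {g : Sym2 V} (p : G.Walk u v) (hg : g ∈ p.edges) :
    ∃ (c d : V) (h : G.Adj c d) (A : G.Walk u c) (B : G.Walk d v),
      g = s(c, d) ∧ p = A.append (Walk.cons h B) := by
  induction p with
  | nil => simp at hg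
  | cons h p ih =>
    rw [Walk.edges_cons, List.mem_cons] at hg
    rcases hg with rfl | hg
    · exact ⟨_, _, h, Walk.nil, p, rfl, rfl⟩
    · obtain ⟨c, d, h', A, B, rfl, rfl⟩ := ih hg
      exact ⟨c, d, h', Walk.cons h A, B, rfl, rfl⟩

omit [DecidableEq V] in
/-- Opening a cycle at one of its edges gives a path between the ends of that edge. -/
theorem IsCycle.exists_isPath_of_mem_edges {a : V} {w : G.Walk a a} (hw : w.IsCycle)
    {e : Sym2 V} (he : e ∈ w.edges) :
    ∃ (c d : V) (_ : G.Adj c d) (P : G.Walk d c), e = s(c, d) ∧ P.IsPath ∧ e ∉ P.edges ∧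
      (∀ g, g ∈ w.edges ↔ g = e ∨ g ∈ P.edges) ∧ ∀ t, t ∈ w.support ↔ t ∈ P.support := by
  obtain ⟨c, d, h, A, B, rfl, rfl⟩ := exists_eq_append_of_mem_edges w he
  have hA : A.support = a :: A.support.tail := (Walk.cons_tail_support A).symm
  refine ⟨c, d, h, B.append A, rfl, ?_, ?_, ?_, ?_⟩
  · have := hw.support_nodup
    rw [Walk.tail_support_append, Walk.support_cons, List.tail_cons] at this
    rw [Walk.isPath_def, Walk.support_append]
    exact List.perm_append_comm.nodup_iff.mp this
  · have := hw.edges_nodup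
    rw [Walk.edges_append, Walk.edges_cons, List.nodup_middle, List.nodup_cons] at this
    rw [Walk.edges_append, List.mem_append, or_comm, ← List.mem_append]
    exact this.1
  · intro g
    simp only [Walk.edges_append, Walk.edges_cons, List.mem_append, List.mem_cons]
    tauto
  · intro t
    simp only [Walk.mem_support_append_iff, Walk.support_cons, List.mem_cons]
    have := A.end_mem_support
    grind

/-- `Q` is an ear on the circle with vertex set `S` and edge set `T`: a path joining two distinct
vertices of the circle and otherwise disjoint from it. -/
structure IsEar (S : Set V) (T : Set (Sym2 V)) (Q : G.Walk x y) : Prop where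
  ne : x ≠ y
  left_mem : x ∈ S
  right_mem : y ∈ S
  isPath : Q.IsPath
  eq_or_eq : ∀ t, t ∈ Q.support → t ∈ S → t = x ∨ t = y
  notMem : ∀ g, g ∈ Q.edges → g ∉ T

omit [DecidableEq V] in
theorem IsEar.reverse {S : Set V} {T : Set (Sym2 V)} {Q : G.Walk x y} (h : IsEar S T Q) :
    IsEar S T Q.reverse where
  ne := h.ne.symm
  left_mem := h.right_mem
  right_mem := h.left_mem
  isPath := h.isPath.reverse
  eq_or_eq t ht hS := (h.eq_or_eq t (by simpa using ht) hS).symm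
  notMem g hg := h.notMem g (by simpa using hg)

omit [DecidableEq V] in
theorem exists_mem_edges_of_ne (Q : G.Walk x y) (h : x ≠ y) : ∃ g, g ∈ Q.edges := by
  cases Q with
  | nil => exact absurd rfl h
  | cons h' q => exact ⟨_, List.mem_cons_self⟩

end Walks

section Ears

variable {G : SimpleGraph V} {u v x y x' y' : V} {σ : Sym2 V → ℤˣ} {e : Sym2 V}

/-- `P` is the complement of the edge `e` in the only positive circle through `e`, expressed by
comparing `P` with the other paths between its ends. -/
structure IsBatteryPath (σ : Sym2 V → ℤˣ) (e : Sym2 V) (P : G.Walk u v) : Prop where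
  isPath : P.IsPath
  notMem : e ∉ P.edges
  wsign_eq : ∀ R : G.Walk u v, R.IsPath → e ∉ R.edges → (∃ g ∈ R.edges, g ∉ P.edges) →
    wsign σ R = -wsign σ P

/-- An ear on the circle formed by `P` and `e`. -/
abbrev IsEarOn (P : G.Walk u v) (e : Sym2 V) (Q : G.Walk x y) : Prop :=
  IsEar {t | t ∈ P.support} {g | g = e ∨ g ∈ P.edges} Q

omit [DecidableEq V] in
theorem wsign_ear {A : G.Walk u x} {M : G.Walk x y} {E : G.Walk y v} {Q : G.Walk x y}
    (hP : IsBatteryPath σ e (A.append (M.append E)))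
    (hQ : IsEarOn (A.append (M.append E)) e Q) : wsign σ Q = -wsign σ M := by
  obtain ⟨h1, h2, h3⟩ := hP
  obtain ⟨q1, q2, q3, q4, q5, q6⟩ := hQ
  obtain ⟨g, hg⟩ := exists_mem_edges_of_ne Q q1
  have := h3 (A.append (Q.append E)) ?_ ?_ ⟨g, ?_, ?_⟩
  · simp only [wsign_append] at this
    generalize wsign σ A = a, wsign σ M = b, wsign σ E = c, wsign σ Q = d at this
    revert a b c d
    decide
  · simp only [isPath_append_iff, Walk.mem_support_append_iff, Set.mem_ofPred_eq] at *
    grind [Walk.start_mem_support, Walk.end_mem_support]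
  · simp only [Walk.edges_append, List.mem_append, Set.mem_ofPred_eq] at *
    grind [Walk.start_mem_support, Walk.end_mem_support]
  · simp [hg]
  · exact fun h => q6 g hg (Or.inr h)

/-- Two ears meeting only in their ends. -/
structure EarsDisjoint (Q : G.Walk x y) (Q' : G.Walk x' y') : Prop where
  eq_or_eq : ∀ t, t ∈ Q.support → t ∈ Q'.support → (t = x ∨ t = y) ∧ (t = x' ∨ t = y')
  disjoint : ∀ g, g ∈ Q.edges → g ∉ Q'.edges

omit [DecidableEq V] in
theorem not_consecutive_ears {A : G.Walk u x} {B : G.Walk x y} {C : G.Walk y x'}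
    {D : G.Walk x' y'} {E : G.Walk y' v} {Q : G.Walk x y} {Q' : G.Walk x' y'}
    (hP : IsBatteryPath σ e (A.append (B.append (C.append (D.append E)))))
    (hQ : IsEarOn (A.append (B.append (C.append (D.append E)))) e Q)
    (hQ' : IsEarOn (A.append (B.append (C.append (D.append E)))) e Q')
    (h : EarsDisjoint Q Q') : False := by
  have s1 := wsign_ear hP hQ
  have s2 : wsign σ Q' = -wsign σ D := by
    refine wsign_ear (A := A.append (B.append C)) (M := D) (E := E) (e := e) ?_ ?_ <;>
      simpa only [← Walk.append_assoc] using ‹_›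
  obtain ⟨h1, h2, h3⟩ := hP
  obtain ⟨q1, q2, q3, q4, q5, q6⟩ := hQ
  obtain ⟨q1', q2', q3', q4', q5', q6'⟩ := hQ'
  obtain ⟨d1, d2⟩ := h
  obtain ⟨g, hg⟩ := exists_mem_edges_of_ne Q q1
  have := h3 (A.append (Q.append (C.append (Q'.append E)))) ?_ ?_ ⟨g, ?_, ?_⟩
  · simp only [wsign_append, s1, s2] at this
    generalize wsign σ A = a, wsign σ B = b, wsign σ C = c, wsign σ D = d, wsign σ E = f at this
    revert a b c d f
    decide
  · simp only [isPath_append_iff, Walk.mem_support_append_iff, Set.mem_ofPred_eq] at *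
    grind [Walk.start_mem_support, Walk.end_mem_support]
  · simp only [Walk.edges_append, List.mem_append, Set.mem_ofPred_eq] at *
    grind [Walk.start_mem_support, Walk.end_mem_support]
  · simp [hg]
  · exact fun h => q6 g hg (Or.inr h)

omit [DecidableEq V] in
theorem not_crossing_ears {A : G.Walk u x} {B : G.Walk x x'} {C : G.Walk x' y}
    {D : G.Walk y y'} {E : G.Walk y' v} {Q : G.Walk x y} {Q' : G.Walk x' y'}
    (hP : IsBatteryPath σ e (A.append (B.append (C.append (D.append E)))))
    (hQ : IsEarOn (A.append (B.append (C.append (D.append E)))) e Q)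
    (hQ' : IsEarOn (A.append (B.append (C.append (D.append E)))) e Q')
    (h : EarsDisjoint Q Q') (hx : x ≠ x') (hy : y ≠ y') (hxy : x' ≠ y) : False := by
  have s1 : wsign σ Q = -wsign σ (B.append C) := by
    refine wsign_ear (A := A) (M := B.append C) (E := D.append E) (e := e) ?_ ?_ <;>
      simpa only [← Walk.append_assoc] using ‹_›
  have s2 : wsign σ Q' = -wsign σ (C.append D) := by
    refine wsign_ear (A := A.append B) (M := C.append D) (E := E) (e := e) ?_ ?_ <;>
      simpa only [← Walk.append_assoc] using ‹_›
  obtain ⟨h1, h2, h3⟩ := hP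
  obtain ⟨q1, q2, q3, q4, q5, q6⟩ := hQ
  obtain ⟨q1', q2', q3', q4', q5', q6'⟩ := hQ'
  obtain ⟨d1, d2⟩ := h
  obtain ⟨g, hg⟩ := exists_mem_edges_of_ne Q q1
  have := h3 (A.append (Q.append (C.reverse.append (Q'.append E)))) ?_ ?_ ⟨g, ?_, ?_⟩
  · simp only [wsign_append, wsign_reverse, s1, s2] at this
    generalize wsign σ A = a, wsign σ B = b, wsign σ C = c, wsign σ D = d, wsign σ E = f at this
    revert a b c d f
    decide
  · simp only [isPath_append_iff, Walk.mem_support_append_iff, Set.mem_ofPred_eq,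
      Walk.isPath_reverse_iff, Walk.support_reverse, List.mem_reverse] at *
    grind [Walk.start_mem_support, Walk.end_mem_support]
  · simp only [Walk.edges_append, List.mem_append, Set.mem_ofPred_eq,
      Walk.edges_reverse, List.mem_reverse] at *
    grind [Walk.start_mem_support, Walk.end_mem_support]
  · simp [hg]
  · exact fun h => q6 g hg (Or.inr h)

theorem exists_circle_of_nested_ears {A : G.Walk u x} {B : G.Walk x x'} {C : G.Walk x' y'}
    {D : G.Walk y' y} {E : G.Walk y v} {Q : G.Walk x y} {Q' : G.Walk x' y'}
    (hP : IsBatteryPath σ e (A.append (B.append (C.append (D.append E)))))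
    (hQ : IsEarOn (A.append (B.append (C.append (D.append E)))) e Q)
    (hQ' : IsEarOn (A.append (B.append (C.append (D.append E)))) e Q')
    (h : EarsDisjoint Q Q') :
    ∃ s, IsCircleOf G s ∧ esign σ s = 1 ∧ (∀ g ∈ Q.edges, g ∈ s) ∧ (∀ g ∈ Q'.edges, g ∈ s) ∧
      ∀ g ∈ s, g ∈ Q.edges ∨ g ∈ Q'.edges ∨
        g ∈ (A.append (B.append (C.append (D.append E)))).edges := by
  have s1 : wsign σ Q = -wsign σ (B.append (C.append D)) := by
    refine wsign_ear (A := A) (M := B.append (C.append D)) (E := E) (e := e) ?_ ?_ <;>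
      simpa only [← Walk.append_assoc] using ‹_›
  have s2 : wsign σ Q' = -wsign σ C := by
    refine wsign_ear (A := A.append B) (M := C) (E := D.append E) (e := e) ?_ ?_ <;>
      simpa only [← Walk.append_assoc] using ‹_›
  obtain ⟨h1, h2, h3⟩ := hP
  obtain ⟨q1, q2, q3, q4, q5, q6⟩ := hQ
  obtain ⟨q1', q2', q3', q4', q5', q6'⟩ := hQ'
  obtain ⟨d1, d2⟩ := h
  have hR : (B.append (Q'.append D)).IsPath := by
    simp only [isPath_append_iff, Walk.mem_support_append_iff, Set.mem_ofPred_eq] at *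
    grind [Walk.start_mem_support, Walk.end_mem_support]
  have hc : (Q.append (B.append (Q'.append D)).reverse).IsCycle := by
    refine isCycle_append q4 hR.reverse q1 ?_ ?_
    · simp only [isPath_append_iff, Walk.mem_support_append_iff, Set.mem_ofPred_eq,
        Walk.support_reverse, List.mem_reverse] at *
      grind [Walk.start_mem_support, Walk.end_mem_support]
    · simp only [Walk.edges_append, List.mem_append, Set.mem_ofPred_eq,
        Walk.edges_reverse, List.mem_reverse] at *
      grind [Walk.start_mem_support, Walk.end_mem_support]
  refine ⟨_, ⟨_, _, hc, rfl⟩, ?_, ?_, ?_, ?_⟩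
  · rw [esign_toFinset_edges σ hc.isTrail]
    simp only [wsign_append, wsign_reverse, s1, s2]
    generalize wsign σ B = b, wsign σ C = c, wsign σ D = d
    revert b c d
    decide
  · intro g hg
    simp [hg]
  · intro g hg
    simp [hg]
  · intro g hg
    simp only [Walk.edges_append, List.mem_append, List.mem_toFinset,
      Walk.edges_reverse, List.mem_reverse] at *
    tauto

omit [DecidableEq V] in
theorem EarsDisjoint.symm {Q : G.Walk x y} {Q' : G.Walk x' y'} (h : EarsDisjoint Q Q') :
    EarsDisjoint Q' Q :=
  ⟨fun t ht ht' => (h.1 t ht' ht).symm, fun g hg hg' => h.2 g hg' hg⟩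

omit [DecidableEq V] in
theorem EarsDisjoint.reverse {Q : G.Walk x y} {Q' : G.Walk x' y'} (h : EarsDisjoint Q Q') :
    EarsDisjoint Q Q'.reverse :=
  ⟨fun t ht ht' => (h.1 t ht (by simpa using ht')).imp_right Or.symm,
    fun g hg hg' => h.2 g hg (by simpa using hg')⟩

omit [DecidableEq V] in
theorem exists_split_four (P : G.Walk u v) {i j k l : ℕ} {p q r s : V} (hij : i ≤ j) (hjk : j ≤ k)
    (hkl : k ≤ l) (hi : P.getVert i = p) (hj : P.getVert j = q) (hk : P.getVert k = r)
    (hl : P.getVert l = s) :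
    ∃ (A : G.Walk u p) (B : G.Walk p q) (C : G.Walk q r) (D : G.Walk r s) (E : G.Walk s v),
      P = A.append (B.append (C.append (D.append E))) := by
  obtain ⟨A, P₁, rfl, h₁⟩ := exists_eq_append_getVert P i hi
  obtain ⟨B, P₂, rfl, h₂⟩ := exists_eq_append_getVert P₁ (j - i) ((h₁ j hij).trans hj)
  obtain ⟨C, P₃, rfl, h₃⟩ := exists_eq_append_getVert P₂ (k - i - (j - i))
    ((h₂ (k - i) (by omega)).trans ((h₁ k (by omega)).trans hk))
  obtain ⟨D, E, rfl, -⟩ := exists_eq_append_getVert P₃ (l - i - (j - i) - (k - i - (j - i)))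
    ((h₃ _ (by omega)).trans ((h₂ (l - i) (by omega)).trans ((h₁ l (by omega)).trans hl)))
  exact ⟨A, B, C, D, E, rfl⟩

theorem exists_circle_of_ordered_ears {P : G.Walk u v} {i j i' j' : ℕ} {Q : G.Walk x y}
    {Q' : G.Walk x' y'} (hP : IsBatteryPath σ e P) (hQ : IsEarOn P e Q) (hQ' : IsEarOn P e Q')
    (h : EarsDisjoint Q Q') (hi : P.getVert i = x) (hj : P.getVert j = y)
    (hi' : P.getVert i' = x') (hj' : P.getVert j' = y') (hij : i < j) (hij' : i' < j')
    (hjl : j ≤ P.length) (hjl' : j' ≤ P.length) :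
    ∃ s, IsCircleOf G s ∧ esign σ s = 1 ∧ (∀ g ∈ Q.edges, g ∈ s) ∧ (∀ g ∈ Q'.edges, g ∈ s) ∧
      ∀ g ∈ s, g ∈ Q.edges ∨ g ∈ Q'.edges ∨ g ∈ P.edges := by
  wlog hii : i < i' ∨ (i = i' ∧ j' ≤ j) generalizing i j i' j' x y x' y'
  · obtain ⟨s, h1, h2, h3, h4, h5⟩ :=
      this hQ' hQ h.symm hi' hj' hi hj hij' hij hjl' hjl (by omega)
    exact ⟨s, h1, h2, h4, h3, fun g hg => by have := h5 g hg; tauto⟩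
  by_cases hjj : j' ≤ j
  · obtain ⟨A, B, C, D, E, rfl⟩ := exists_split_four P (by omega : i ≤ i') hij'.le hjj hi hi' hj' hj
    exact exists_circle_of_nested_ears hP hQ hQ' h
  · exfalso
    by_cases hji : j ≤ i'
    · obtain ⟨A, B, C, D, E, rfl⟩ := exists_split_four P hij.le hji hij'.le hi hj hi' hj'
      exact not_consecutive_ears hP hQ hQ' h
    have hne : ∀ m n, m < n → n ≤ P.length → P.getVert m ≠ P.getVert n := fun m n hmn hn hmn' =>
      hmn.ne (hP.isPath.getVert_injOn (hmn.le.trans hn) hn hmn')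
    have h₁ := hne i i' (by omega) (by omega)
    have h₂ := hne i' j (by omega) (by omega)
    have h₃ := hne j j' (by omega) (by omega)
    rw [hi, hi'] at h₁
    rw [hi', hj] at h₂
    rw [hj, hj'] at h₃
    obtain ⟨A, B, C, D, E, rfl⟩ := exists_split_four P (by omega : i ≤ i') (by omega : i' ≤ j)
        (by omega : j ≤ j') hi hi' hj hj'
    exact not_crossing_ears hP hQ hQ' h h₁ h₃ h₂

theorem exists_circle_of_disjoint_ears {P : G.Walk u v} {Q : G.Walk x y} {Q' : G.Walk x' y'}
    (hP : IsBatteryPath σ e P) (hQ : IsEarOn P e Q) (hQ' : IsEarOn P e Q')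
    (h : EarsDisjoint Q Q') :
    ∃ s, IsCircleOf G s ∧ esign σ s = 1 ∧ (∀ g ∈ Q.edges, g ∈ s) ∧ (∀ g ∈ Q'.edges, g ∈ s) ∧
      ∀ g ∈ s, g ∈ Q.edges ∨ g ∈ Q'.edges ∨ g ∈ P.edges := by
  obtain ⟨i, hi, hil⟩ := Walk.mem_support_iff_exists_getVert.mp hQ.left_mem
  obtain ⟨j, hj, hjl⟩ := Walk.mem_support_iff_exists_getVert.mp hQ.right_mem
  obtain ⟨i', hi', hil'⟩ := Walk.mem_support_iff_exists_getVert.mp hQ'.left_mem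
  obtain ⟨j', hj', hjl'⟩ := Walk.mem_support_iff_exists_getVert.mp hQ'.right_mem
  wlog hij : i < j generalizing x y i j Q
  · have hne : j ≠ i := by
      rintro rfl
      exact hQ.ne (hi.symm.trans hj)
    simpa using this hQ.reverse h.symm.reverse.symm j hj hjl i hi hil (by omega)
  wlog hij' : i' < j' generalizing x' y' i' j' Q'
  · have hne : j' ≠ i' := by
      rintro rfl
      exact hQ'.ne (hi'.symm.trans hj')
    simpa using this hQ'.reverse j' hj' hjl' i' hi' hil' h.reverse (by omega)
  exact exists_circle_of_ordered_ears hP hQ hQ' h hi hj hi' hj' hij hij' hjl hjl'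

end Ears

section ExistsEar

variable {G : SimpleGraph V} {u v x y p q z : V} {S : Set V} {T : Set (Sym2 V)}

omit [DecidableEq V] in
theorem exists_isPath_first_mem (W : G.Walk q z) (hz : z ∈ S) :
    ∃ z' ∈ S, ∃ R : G.Walk q z', R.IsPath ∧ (∀ t ∈ R.support, t ∈ W.support) ∧
      ∀ t ∈ R.support, t ∈ S → t = z' := by
  classical
  induction W with
  | nil => exact ⟨_, hz, Walk.nil, by simp, by simp, by simp⟩
  | @cons a b c h W ih =>
    by_cases ha : a ∈ S
    · exact ⟨a, ha, Walk.nil, by simp, by simp, by simp⟩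
    · obtain ⟨z', hz', R, -, h2, h3⟩ := ih hz
      refine ⟨z', hz', (Walk.cons h R).bypass, Walk.bypass_isPath _, ?_, ?_⟩
      · intro t ht
        have := Walk.support_bypass_subset_support _ ht
        rw [Walk.support_cons, List.mem_cons] at this ⊢
        exact this.imp_right (h2 t)
      · intro t ht htS
        have := Walk.support_bypass_subset_support _ ht
        rw [Walk.support_cons, List.mem_cons] at this
        rcases this with rfl | h
        · exact absurd htS ha
        · exact h3 t h htS

omit [DecidableEq V] in
/-- In a block, a vertex `q ≠ p` can be joined to any set with a vertex other than `p` by a path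
which avoids `p` and stops as soon as it meets the set. -/
theorem IsBlock.exists_isPath_avoiding (hG : IsBlock G) (hq : q ≠ p) (hz : z ∈ S) (hzp : z ≠ p) :
    ∃ z' ∈ S, ∃ R : G.Walk q z', R.IsPath ∧ p ∉ R.support ∧ ∀ t ∈ R.support, t ∈ S → t = z' := by
  obtain ⟨W⟩ := (hG.2 p).preconnected ⟨q, by simpa using hq⟩ ⟨z, by simpa using hzp⟩
  obtain ⟨z', hz', R, h1, h2, h3⟩ :=
    exists_isPath_first_mem (S := S) (W.map (Subgraph.hom _)) hz
  refine ⟨z', hz', R, h1, fun hp => ?_, h3⟩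
  have := h2 p hp
  rw [Walk.support_map, List.mem_map] at this
  obtain ⟨⟨t, ht⟩, -, htp⟩ := this
  change t = p at htp
  subst htp
  simp at ht

omit [DecidableEq V] in
theorem eq_or_eq_of_mem_edges {Q : G.Walk x y} (hQ : Q.IsPath) (h : s(x, y) ∈ Q.edges) :
    ∀ t ∈ Q.support, t = x ∨ t = y := by
  cases Q with
  | nil => simp
  | @cons _ b _ hb W =>
    rw [Walk.cons_isPath_iff] at hQ
    rw [Walk.edges_cons, List.mem_cons] at h
    rcases h with h | h
    · obtain rfl : y = b := by
        rcases Sym2.eq_iff.mp h with h | h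
        · exact h.2
        · exact absurd h.1 hb.ne
      rw [Walk.isPath_iff_nil] at hQ
      simp [Walk.nil_iff_support_eq.mp hQ.1]
    · exact absurd (W.fst_mem_support_of_mem_edges h) hQ.2

omit [DecidableEq V] in
/-- A path through a vertex off the circle, with only its ends on the circle, is an ear. -/
theorem IsEar.of_mem_support (hT : ∀ g ∈ T, ∀ t ∈ g, t ∈ S) {Q : G.Walk x y} (hxy : x ≠ y)
    (hx : x ∈ S) (hy : y ∈ S) (hQ : Q.IsPath)
    (h : ∀ t, t ∈ Q.support → t ∈ S → t = x ∨ t = y) (hp : p ∈ Q.support) (hpS : p ∉ S) :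
    IsEar S T Q := by
  refine ⟨hxy, hx, hy, hQ, h, fun g hg hgT => hpS ?_⟩
  suffices hg' : g = s(x, y) by
    rcases eq_or_eq_of_mem_edges hQ (hg' ▸ hg) p hp with rfl | rfl
    · exact hx
    · exact hy
  induction g with
  | _ c d =>
    have hcd := (Q.adj_of_mem_edges hg).ne
    have hc := h c (Q.fst_mem_support_of_mem_edges hg) (hT _ hgT c (Sym2.mem_mk_left c d))
    have hd := h d (Q.snd_mem_support_of_mem_edges hg) (hT _ hgT d (Sym2.mem_mk_right c d))
    rw [Sym2.eq_iff]
    grind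

omit [DecidableEq V] in
theorem exists_ear_of_mem (hG : IsBlock G) (hT : ∀ g ∈ T, ∀ t ∈ g, t ∈ S) (hp : p ∈ S)
    (hz : z ∈ S) (hzp : z ≠ p) (h : G.Adj p q) (hpq : s(p, q) ∉ T) :
    ∃ (x y : V) (Q : G.Walk x y), IsEar S T Q ∧ s(p, q) ∈ Q.edges := by
  obtain ⟨z', hz', R, h1, h2, h3⟩ := hG.exists_isPath_avoiding h.ne' hz hzp
  refine ⟨p, z', Walk.cons h R, ⟨?_, hp, hz', ?_, ?_, ?_⟩, by simp⟩
  · rintro rfl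
    exact h2 R.end_mem_support
  · exact (Walk.cons_isPath_iff _ _).mpr ⟨h1, h2⟩
  · intro t ht htS
    rw [Walk.support_cons, List.mem_cons] at ht
    exact ht.imp_right fun ht => h3 t ht htS
  · intro g hg hgT
    rw [Walk.edges_cons, List.mem_cons] at hg
    rcases hg with rfl | hg
    · exact hpq hgT
    · induction g with
      | _ c d =>
        have hc := h3 c (R.fst_mem_support_of_mem_edges hg) (hT _ hgT c (Sym2.mem_mk_left c d))
        have hd := h3 d (R.snd_mem_support_of_mem_edges hg) (hT _ hgT d (Sym2.mem_mk_right c d))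
        exact (R.adj_of_mem_edges hg).ne (hc.trans hd.symm)

omit [DecidableEq V] in
theorem exists_ear_of_ear (hG : IsBlock G) (hT : ∀ g ∈ T, ∀ t ∈ g, t ∈ S) (hp : p ∉ S)
    {Q : G.Walk x y} (hQ : IsEar S T Q) (hpQ : p ∈ Q.support) (h : G.Adj p q) :
    ∃ (x y : V) (Q : G.Walk x y), IsEar S T Q ∧ s(p, q) ∈ Q.edges := by
  have hxp : x ≠ p := fun h => hp (h ▸ hQ.left_mem)
  obtain ⟨z, hz, R, h1, h2, h3⟩ :=
    hG.exists_isPath_avoiding (S := {t | t ∈ S ∨ t ∈ Q.support}) h.ne' (Or.inl hQ.left_mem) hxp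
  wlog hzx : z ≠ x ∧ (z ∈ S ∨ ∃ (A : G.Walk x p) (B : G.Walk p z) (C : G.Walk z y),
      Q = A.append (B.append C)) generalizing x y Q
  · refine this hQ.reverse (by simpa using hpQ) (fun h => hp (h ▸ hQ.right_mem))
      (by simpa using hz) (by simpa using h3) ?_
    obtain ⟨A, B, rfl⟩ := Walk.mem_support_iff_exists_append.mp hpQ
    have hxy := hQ.ne
    have hzp : z ≠ p := by
      rintro rfl
      exact h2 R.end_mem_support
    by_cases hzS : z ∈ S
    · have : z = x := by tauto
      exact ⟨this ▸ hxy, Or.inl hzS⟩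
    · have hzy : z ≠ y := fun h => hzS (h ▸ hQ.right_mem)
      have hzx' : z ≠ x := fun h => hzS (h ▸ hQ.left_mem)
      refine ⟨hzy, Or.inr ?_⟩
      have hz' : z ∈ (A.append B).support := hz.resolve_left hzS
      rw [Walk.mem_support_append_iff] at hz'
      rcases hz' with hz' | hz'
      · obtain ⟨C, D, rfl⟩ := Walk.mem_support_iff_exists_append.mp hz'
        exact ⟨B.reverse, D.reverse, C.reverse, by simp [Walk.append_assoc]⟩
      · obtain ⟨C, D, rfl⟩ := Walk.mem_support_iff_exists_append.mp hz'
        exact absurd ⟨hzx', Or.inr ⟨A, C, D, rfl⟩⟩ hzx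
  obtain ⟨hzx, hzS | ⟨A, B, C, rfl⟩⟩ := hzx
  · obtain ⟨A, B, rfl⟩ := Walk.mem_support_iff_exists_append.mp hpQ
    obtain ⟨q1, q2, q3, q4, q5, q6⟩ := hQ
    refine ⟨x, z, A.append (Walk.cons h R),
      IsEar.of_mem_support hT hzx.symm q2 hzS ?_ ?_ (p := p) (by simp) hp, by simp⟩
    · simp only [isPath_append_iff, Walk.mem_support_append_iff, Set.mem_ofPred_eq,
        Walk.cons_isPath_iff, Walk.support_cons, List.mem_cons] at *
      grind [Walk.start_mem_support, Walk.end_mem_support]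
    · simp only [isPath_append_iff, Walk.mem_support_append_iff, Set.mem_ofPred_eq,
        Walk.support_cons, List.mem_cons] at *
      grind [Walk.start_mem_support, Walk.end_mem_support]
  · obtain ⟨q1, q2, q3, q4, q5, q6⟩ := hQ
    refine ⟨x, y, A.append ((Walk.cons h R).append C),
      IsEar.of_mem_support hT q1 q2 q3 ?_ ?_ (p := p) (by simp) hp, by simp⟩
    · simp only [isPath_append_iff, Walk.mem_support_append_iff, Set.mem_ofPred_eq,
        Walk.cons_isPath_iff, Walk.support_cons, List.mem_cons] at *
      grind [Walk.start_mem_support, Walk.end_mem_support]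
    · simp only [isPath_append_iff, Walk.mem_support_append_iff, Set.mem_ofPred_eq,
        Walk.support_cons, List.mem_cons] at *
      grind [Walk.start_mem_support, Walk.end_mem_support]

omit [DecidableEq V] in
/-- In a block, every edge off a circle lies in an ear of that circle. -/
theorem exists_ear_of_mem_edgeSet (hG : IsBlock G) (hT : ∀ g ∈ T, ∀ t ∈ g, t ∈ S)
    (hS : S.Nontrivial) {g : Sym2 V} (hg : g ∈ G.edgeSet) (hgT : g ∉ T) :
    ∃ (x y : V) (Q : G.Walk x y), IsEar S T Q ∧ g ∈ Q.edges := by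
  have step : ∀ p q, (p ∈ S ∨ ∃ (x y : V) (Q : G.Walk x y), IsEar S T Q ∧ p ∈ Q.support) →
      G.Adj p q → s(p, q) ∉ T →
      ∃ (x y : V) (Q : G.Walk x y), IsEar S T Q ∧ s(p, q) ∈ Q.edges := by
    intro p q hp h hpq
    by_cases hpS : p ∈ S
    · obtain ⟨z, hz, hzp⟩ := hS.exists_ne p
      exact exists_ear_of_mem hG hT hpS hz hzp h hpq
    · obtain ⟨x, y, Q, hQ, hpQ⟩ := hp.resolve_left hpS
      exact exists_ear_of_ear hG hT hpS hQ hpQ h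
  have walk : ∀ p q (_ : G.Walk p q),
      (p ∈ S ∨ ∃ (x y : V) (Q : G.Walk x y), IsEar S T Q ∧ p ∈ Q.support) →
      (q ∈ S ∨ ∃ (x y : V) (Q : G.Walk x y), IsEar S T Q ∧ q ∈ Q.support) := by
    intro p q W
    induction W with
    | nil => exact id
    | @cons a b c h W ih =>
      refine fun ha => ih ?_
      by_cases hab : s(a, b) ∈ T
      · exact Or.inl (hT _ hab b (Sym2.mem_mk_right a b))
      · obtain ⟨x, y, Q, hQ, hg⟩ := step a b ha h hab
        exact Or.inr ⟨x, y, Q, hQ, Q.snd_mem_support_of_mem_edges hg⟩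
  obtain ⟨a, ha⟩ := hS.nonempty
  induction g with
  | _ p q =>
    obtain ⟨W⟩ := hG.1.preconnected a p
    exact step p q (walk a p W (Or.inl ha)) hg hgT

end ExistsEar

section Bridges

variable {G : SimpleGraph V} {x y x' y' a : V} {S : Set V} {T : Set (Sym2 V)}
  {F F' : Set (Sym2 V)} {w : G.Walk a a}

/-- `F` contains with each edge all edges of `G` that meet it in a vertex off `S`. -/
def IsClosedOff (G : SimpleGraph V) (S : Set V) (F : Set (Sym2 V)) : Prop :=
  ∀ g ∈ F, ∀ g' ∈ G.edgeSet, ∀ t, t ∉ S → t ∈ g → t ∈ g' → g' ∈ F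

omit [DecidableEq V] in
theorem IsClosedOff.mem_of_isPath (hF : IsClosedOff G S F) (W : G.Walk x y) (hW : W.IsPath)
    (h : ∀ t ∈ W.support.tail, t ∈ S → t = y) {g g' : Sym2 V} (hg : g ∈ W.edges) (hgF : g ∈ F)
    (hg' : g' ∈ W.edges) : g' ∈ F := by
  induction W generalizing g g' with
  | nil => simp at hg
  | @cons p q _ hpq W ih =>
    cases W with
    | nil =>
      simp only [Walk.edges_cons, Walk.edges_nil, List.mem_singleton] at hg hg'
      exact hg' ▸ hg ▸ hgF
    | @cons _ r _ hqr W =>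
      have hW' := hW.of_cons
      have hqS : q ∉ S := fun hq => by
        have := h q (by simp) hq
        subst this
        exact ((Walk.cons_isPath_iff _ _).mp hW').2 W.end_mem_support
      have ih' := @ih hW' fun t ht htS => h t (by simpa using Or.inr ht) htS
      have hr : s(q, r) ∈ (Walk.cons hqr W).edges := by simp
      rw [Walk.edges_cons, List.mem_cons] at hg hg'
      have hqr' : s(q, r) ∈ F := by
        rcases hg with rfl | hg
        · exact hF _ hgF _ hqr q hqS (Sym2.mem_mk_right p q) (Sym2.mem_mk_left q r)
        · exact ih' hg hgF hr
      rcases hg' with rfl | hg'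
      · exact hF _ hqr' _ hpq q hqS (Sym2.mem_mk_left q r) (Sym2.mem_mk_right p q)
      · exact ih' hr hqr' hg'

omit [DecidableEq V] in
theorem IsClosedOff.mem_of_isEar (hF : IsClosedOff G S F) {Q : G.Walk x y} (hQ : IsEar S T Q)
    {g g' : Sym2 V} (hg : g ∈ Q.edges) (hgF : g ∈ F) (hg' : g' ∈ Q.edges) : g' ∈ F := by
  refine hF.mem_of_isPath Q hQ.isPath (fun t ht htS => ?_) hg hgF hg'
  have hs := hQ.isPath.support_nodup
  rw [← Walk.cons_tail_support, List.nodup_cons] at hs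
  refine (hQ.eq_or_eq t (List.mem_of_mem_tail ht) htS).resolve_left ?_
  rintro rfl
  exact hs.1 ht

omit [DecidableEq V] in
theorem IsClosedOff.earsDisjoint (hF : IsClosedOff G S F) {Q : G.Walk x y} {Q' : G.Walk x' y'}
    (hQ : IsEar S T Q) (hQ' : IsEar S T Q') (h : ∀ g ∈ Q.edges, g ∉ F)
    (h' : ∀ g ∈ Q'.edges, g ∈ F) : EarsDisjoint Q Q' := by
  refine ⟨fun t ht ht' => ?_, fun g hg hg' => h g hg (h' g hg')⟩
  suffices htS : t ∈ S from ⟨hQ.eq_or_eq t ht htS, hQ'.eq_or_eq t ht' htS⟩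
  by_contra htS
  obtain ⟨g, hg, htg⟩ :=
    (Walk.mem_support_iff_exists_mem_edges_of_not_nil (Walk.not_nil_of_ne hQ.ne)).mp ht
  obtain ⟨g', hg', htg'⟩ :=
    (Walk.mem_support_iff_exists_mem_edges_of_not_nil (Walk.not_nil_of_ne hQ'.ne)).mp ht'
  exact h g hg (hF g' (h' g' hg') g (Q.edges_subset_edgeSet hg) t htS htg' htg)

omit [DecidableEq V] in
theorem IsBridgeOf.isClosedOff (h : IsBridgeOf G w F) :
    IsClosedOff G {t | t ∈ w.support} F := by
  rintro g hg g' hg' t ht htg htg'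
  obtain ⟨x, y, -, hx, hy, -, -, rfl⟩ | ⟨D, -, -, -, hD, rfl⟩ := h
  · rw [Set.mem_singleton_iff] at hg
    subst hg
    rcases Sym2.mem_iff.mp htg with rfl | rfl
    · exact absurd hx ht
    · exact absurd hy ht
  · obtain ⟨hgG, p, hp, hpg⟩ := hg
    refine ⟨hg', t, ?_, htg'⟩
    by_cases hpt : p = t
    · exact hpt ▸ hp
    · obtain rfl := (Sym2.mem_and_mem_iff hpt).mp ⟨hpg, htg⟩
      exact (hD p hp t hgG).resolve_right ht

omit [DecidableEq V] in
theorem IsBridgeOf.subset_edgeSet (h : IsBridgeOf G w F) : F ⊆ G.edgeSet := by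
  obtain ⟨x, y, -, -, -, hxy, -, rfl⟩ | ⟨D, -, -, -, -, rfl⟩ := h
  · simpa using hxy
  · exact fun g hg => hg.1

omit [DecidableEq V] in
theorem IsBridgeOf.notMem_edges (h : IsBridgeOf G w F) {g : Sym2 V} (hg : g ∈ F) :
    g ∉ w.edges := by
  obtain ⟨x, y, -, -, -, -, hxy, rfl⟩ | ⟨D, -, hD, -, -, rfl⟩ := h
  · exact hg ▸ hxy
  · obtain ⟨-, p, hp, hpg⟩ := hg
    exact fun hgw => hD p hp (w.mem_support_of_mem_edges hgw hpg)

omit [DecidableEq V] in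
theorem IsBridgeOf.nonempty (hG : G.Connected) (h : IsBridgeOf G w F) : F.Nonempty := by
  obtain ⟨x, y, -, -, -, -, -, rfl⟩ | ⟨D, ⟨p, hp⟩, hD, -, -, rfl⟩ := h
  · exact Set.singleton_nonempty _
  · have hpa : p ≠ a := fun h => hD p hp (h ▸ w.start_mem_support)
    obtain ⟨W⟩ := hG.preconnected p a
    cases W with
    | nil => exact absurd rfl hpa
    | cons h W => exact ⟨_, h, p, hp, Sym2.mem_mk_left _ _⟩

omit [DecidableEq V] in
/-- A connected set of vertices off the circle lies in any component that it meets. -/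
theorem subset_of_connected_induce {D D' : Set V} (hD : ∀ x ∈ D, x ∉ w.support)
    (hc : (G.induce D).Connected) (hD' : ∀ x ∈ D', ∀ y, G.Adj x y → y ∈ D' ∨ y ∈ w.support)
    {p : V} (hp : p ∈ D) (hp' : p ∈ D') : D ⊆ D' := by
  intro q hq
  obtain ⟨W⟩ := hc.preconnected ⟨p, hp⟩ ⟨q, hq⟩
  suffices h : ∀ (b c : D), (G.induce D).Walk b c → (b : V) ∈ D' → (c : V) ∈ D' from h _ _ W hp'
  intro b c W
  induction W with
  | nil => exact id
  | @cons b c d h W ih =>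
    exact fun hb => ih ((hD' b hb c h).resolve_right (hD c c.2))

omit [DecidableEq V] in
theorem IsBridgeOf.eq_of_mem (h : IsBridgeOf G w F) (h' : IsBridgeOf G w F') {g : Sym2 V}
    (hg : g ∈ F) (hg' : g ∈ F') : F = F' := by
  obtain ⟨x, y, -, hx, hy, -, -, rfl⟩ | ⟨D, -, hD, hDc, hDw, rfl⟩ := h <;>
    obtain ⟨x', y', -, hx', hy', -, -, rfl⟩ | ⟨D', -, hD', hDc', hDw', rfl⟩ := h'
  · rw [← Set.mem_singleton_iff.mp hg, ← Set.mem_singleton_iff.mp hg']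
  · obtain ⟨-, p, hp, hpg⟩ := hg'
    rw [Set.mem_singleton_iff.mp hg] at hpg
    rcases Sym2.mem_iff.mp hpg with rfl | rfl
    · exact absurd hx (hD' _ hp)
    · exact absurd hy (hD' _ hp)
  · obtain ⟨-, p, hp, hpg⟩ := hg
    rw [Set.mem_singleton_iff.mp hg'] at hpg
    rcases Sym2.mem_iff.mp hpg with rfl | rfl
    · exact absurd hx' (hD _ hp)
    · exact absurd hy' (hD _ hp)
  · obtain ⟨hgG, p, hp, hpg⟩ := hg
    obtain ⟨-, p', hp', hpg'⟩ := hg'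
    have hpD' : p ∈ D' := by
      by_cases hpp : p' = p
      · exact hpp ▸ hp'
      · obtain rfl := (Sym2.mem_and_mem_iff hpp).mp ⟨hpg', hpg⟩
        exact (hDw' p' hp' p hgG).resolve_right (hD p hp)
    obtain rfl : D = D' := (subset_of_connected_induce hD hDc hDw' hp hpD').antisymm
      (subset_of_connected_induce hD' hDc' hDw hpD' hp)
    rfl

end Bridges

section Main

variable {G : SimpleGraph V} {σ : Sym2 V → ℤˣ} {a : V} {w : G.Walk a a} {e f : Sym2 V}
  {F F' : Set (Sym2 V)}

theorem isBatteryPath_of_unique (hbat : esign σ w.edges.toFinset = 1 ∧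
      ∀ s : Finset (Sym2 V), IsCircleOf G s → e ∈ s → esign σ s = 1 → s = w.edges.toFinset)
    {c d : V} (h : G.Adj c d) {P : G.Walk d c} (hecd : e = s(c, d)) (hP : P.IsPath)
    (he : e ∉ P.edges) (hw : ∀ g, g ∈ w.edges ↔ g = e ∨ g ∈ P.edges) :
    IsBatteryPath σ e P := by
  subst hecd
  have circle : ∀ R : G.Walk d c, R.IsPath → s(c, d) ∉ R.edges → (Walk.cons h R).IsCycle :=
    fun R hR heR => (Walk.cons_isCycle_iff R h).mpr ⟨hR, heR⟩
  have sign : ∀ R : G.Walk d c, wsign σ (Walk.cons h R) = σ s(c, d) * wsign σ R :=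
    fun R => by simp [wsign]
  have hwP : w.edges.toFinset = (Walk.cons h P).edges.toFinset := by
    ext g
    simp [hw]
  refine ⟨hP, he, fun R hR heR ⟨g, hg, hgP⟩ => ?_⟩
  by_contra hne
  have hRP : wsign σ R = wsign σ P := by
    rcases Int.units_eq_one_or (wsign σ R) with h | h <;>
      rcases Int.units_eq_one_or (wsign σ P) with h' | h' <;> simp_all
  have hs := hbat.2 _ ⟨_, _, circle R hR heR, rfl⟩ (by simp) (by
    rw [esign_toFinset_edges σ (circle R hR heR).isTrail, sign, hRP, ← sign,
      ← esign_toFinset_edges σ (circle P hP he).isTrail, ← hwP, hbat.1])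
  have hgw : g ∈ w.edges.toFinset := hs ▸ by simp [hg]
  rw [List.mem_toFinset, hw] at hgw
  rcases hgw with rfl | hgw
  · exact heR hg
  · exact hgP hgw

theorem not_existsUnique_of_two_bridges (hG : IsBlock G) (hw : w.IsCycle) (he : e ∈ w.edges)
    (hbat : esign σ w.edges.toFinset = 1 ∧
      ∀ s : Finset (Sym2 V), IsCircleOf G s → e ∈ s → esign σ s = 1 → s = w.edges.toFinset)
    (hF : IsBridgeOf G w F) (hF' : IsBridgeOf G w F') (hFF' : F ≠ F')
    (hf : f ∈ G.edgeSet) (hfw : f ∉ w.edges) (hfF : f ∉ F) (hfF' : f ∉ F') :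
    ¬ ∃! s : Finset (Sym2 V), IsCircleOf G s ∧ f ∈ s ∧ esign σ s = 1 := by
  obtain ⟨c, d, hcd, P, hecd, hP, heP, hwP, hsP⟩ := IsCycle.exists_isPath_of_mem_edges hw he
  have hbP := isBatteryPath_of_unique hbat hcd hecd hP heP hwP
  have hT : ∀ g ∈ {g | g = e ∨ g ∈ P.edges}, ∀ t ∈ g, t ∈ {t | t ∈ P.support} :=
    fun g hg t ht => (hsP t).mp (w.mem_support_of_mem_edges ((hwP g).mpr hg) ht)
  have hS : {t | t ∈ P.support}.Nontrivial :=
    ⟨c, P.end_mem_support, d, P.start_mem_support, hcd.ne⟩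
  have hSw : {t | t ∈ w.support} = {t | t ∈ P.support} := Set.ext hsP
  have ear : ∀ g ∈ G.edgeSet, g ∉ w.edges →
      ∃ (x y : V) (Q : G.Walk x y), IsEarOn P e Q ∧ g ∈ Q.edges := fun g hg hgw =>
    exists_ear_of_mem_edgeSet hG hT hS hg fun hgT => hgw ((hwP g).mpr hgT)
  obtain ⟨x, y, Q, hQ, hfQ⟩ := ear f hf hfw
  have circle : ∀ K, IsBridgeOf G w K → f ∉ K → ∃ s, IsCircleOf G s ∧ f ∈ s ∧ esign σ s = 1 ∧
      (∃ k ∈ s, k ∈ K) ∧ ∀ k ∈ s, k ∉ Q.edges → k ∉ w.edges → k ∈ K := by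
    intro K hK hfK
    have hcl : IsClosedOff G {t | t ∈ P.support} K := hSw ▸ hK.isClosedOff
    obtain ⟨k, hk⟩ := hK.nonempty hG.1
    obtain ⟨x', y', Q', hQ', hkQ'⟩ := ear k (hK.subset_edgeSet hk) (hK.notMem_edges hk)
    have hQK : ∀ g ∈ Q.edges, g ∉ K := fun g hg hgK => hfK (hcl.mem_of_isEar hQ hg hgK hfQ)
    have hQ'K : ∀ g ∈ Q'.edges, g ∈ K := fun g hg => hcl.mem_of_isEar hQ' hkQ' hk hg
    obtain ⟨s, h1, h2, h3, h4, h5⟩ :=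
      exists_circle_of_disjoint_ears hbP hQ hQ' (hcl.earsDisjoint hQ hQ' hQK hQ'K)
    refine ⟨s, h1, h3 f hfQ, h2, ⟨k, h4 k hkQ', hk⟩, fun l hl hlQ hlw => ?_⟩
    rcases h5 l hl with h | h | h
    · exact absurd h hlQ
    · exact hQ'K l h
    · exact absurd ((hwP l).mpr (Or.inr h)) hlw
  obtain ⟨s, h1, h2, h3, ⟨k, hks, hk⟩, -⟩ := circle F hF hfF
  obtain ⟨s', h1', h2', h3', -, h5'⟩ := circle F' hF' hfF'
  intro hu
  obtain rfl := hu.unique ⟨h1, h2, h3⟩ ⟨h1', h2', h3'⟩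
  have hkQ : k ∉ Q.edges := fun hkQ => hfF
    ((hSw ▸ hF.isClosedOff : IsClosedOff G {t | t ∈ P.support} F).mem_of_isEar hQ hkQ hk hfQ)
  exact hFF' (hF.eq_of_mem hF' hk (h5' k hks hkQ (hF.notMem_edges hk)))

end Main

theorem three_bridges_no_positive_battery_outside {V : Type*} [DecidableEq V]
    (G : SimpleGraph V) (σ : Sym2 V → ℤˣ) (hG : IsBlock G)
    {a : V} (w : G.Walk a a) (hw : w.IsCycle)
    (hnc : ∃ g ∈ G.edgeSet, g ∉ w.edges)
    -- `e` is a positive battery with unique positive circle `C`: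
    (e : Sym2 V) (he : e ∈ w.edges)
    (hbat : esign σ w.edges.toFinset = 1 ∧
      ∀ s : Finset (Sym2 V), IsCircleOf G s → e ∈ s → esign σ s = 1 →
        s = w.edges.toFinset)
    -- `C` has three or more bridges:
    (F₁ F₂ F₃ : Set (Sym2 V)) (hF₁ : IsBridgeOf G w F₁) (hF₂ : IsBridgeOf G w F₂)
    (hF₃ : IsBridgeOf G w F₃)
    (h₁₂ : F₁ ≠ F₂) (h₁₃ : F₁ ≠ F₃) (h₂₃ : F₂ ≠ F₃) :
    -- no edge outside of `C` lies in a unique positive circle: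
    ∀ f ∈ G.edgeSet, f ∉ w.edges →
      ¬ (∃! s : Finset (Sym2 V), IsCircleOf G s ∧ f ∈ s ∧ esign σ s = 1) := by
  intro f hf hfw
  have key : ∀ F F', IsBridgeOf G w F → IsBridgeOf G w F' → F ≠ F' → f ∉ F → f ∉ F' →
      ¬ ∃! s : Finset (Sym2 V), IsCircleOf G s ∧ f ∈ s ∧ esign σ s = 1 :=
    fun F F' hF hF' hFF' => not_existsUnique_of_two_bridges hG hw he hbat hF hF' hFF' hf hfw
  by_cases hf₁ : f ∈ F₁
  · exact key F₂ F₃ hF₂ hF₃ h₂₃ (fun hf₂ => h₁₂ (hF₁.eq_of_mem hF₂ hf₁ hf₂))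
      (fun hf₃ => h₁₃ (hF₁.eq_of_mem hF₃ hf₁ hf₃))
  · by_cases hf₂ : f ∈ F₂
    · exact key F₁ F₃ hF₁ hF₃ h₁₃ hf₁ (fun hf₃ => h₂₃ (hF₂.eq_of_mem hF₃ hf₂ hf₃))
    · exact key F₁ F₂ hF₁ hF₂ h₁₂ hf₁ hf₂
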